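/- arXiv:1009.0912 — 2 statements merged into one kernel-verified Lean document; each statement's English description precedes it below -/
import Mathlib

section
/- For every t > 0, s > 0 and x ∈ ℝ, (1/(2π)) ∫_ℝ exp{(iλ³/3 − (1/2)·s·λ²)·t + iλx} dλ = exp{s³t/12 + s·x/2} · t^{−1/3} · Ai( t^{−1/3}·(x + s²t/4) ). -/
open MeasureTheory Filter

/-- The integrand of the Airy integral with the cubic term scaled by `t`, as an entire function. -/
noncomputable def airyKernel (t y : ℝ) (z : ℂ) : ℂ :=
  Complex.exp (Complex.I * (t * z ^ 3 / 3 + z * y))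

lemma differentiable_airyKernel (t y : ℝ) : Differentiable ℂ (airyKernel t y) := by
  unfold airyKernel
  fun_prop

lemma norm_airyKernel (t y a b : ℝ) :
    ‖airyKernel t y (a + b * Complex.I)‖
      = Real.exp (-(t * b * a ^ 2) + (t * b ^ 3 / 3 - b * y)) := by
  have h : Complex.I * (t * ((a : ℂ) + b * Complex.I) ^ 3 / 3 + (a + b * Complex.I) * y)
      = ((-(t * b * a ^ 2) + (t * b ^ 3 / 3 - b * y) : ℝ) : ℂ)
        + ((t * a ^ 3 / 3 - t * a * b ^ 2 + a * y : ℝ) : ℂ) * Complex.I := by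
    push_cast
    linear_combination (t * (a : ℂ) ^ 2 * b + t * a * b ^ 2 * Complex.I
      + t * b ^ 3 / 3 * (Complex.I ^ 2 - 1) + b * y) * Complex.I_sq
  rw [airyKernel, h, Complex.norm_exp, Complex.add_re, Complex.ofReal_re, Complex.re_ofReal_mul,
    Complex.I_re, mul_zero, add_zero]

lemma integrable_airyKernel_horizontal {t c : ℝ} (ht : 0 < t) (hc : 0 < c) (y : ℝ) :
    Integrable (fun l : ℝ => airyKernel t y (l + c * Complex.I)) := by
  have hg := (integrable_exp_neg_mul_sq (mul_pos ht hc)).mul_const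
    (Real.exp (t * c ^ 3 / 3 - c * y))
  refine hg.mono' ?_ (ae_of_all _ fun l => ?_)
  · exact ((differentiable_airyKernel t y).continuous.comp (by fun_prop)).aestronglyMeasurable
  · rw [norm_airyKernel, Real.exp_add, neg_mul]

lemma tendsto_integral_airyKernel_vertical {t c : ℝ} (ht : 0 < t) (hc : 0 < c) (y : ℝ)
    {a : ℝ → ℝ} (ha : Tendsto (fun R => a R ^ 2) atTop atTop) :
    Tendsto (fun R => ∫ u : ℝ in 0..c, airyKernel t y (a R + u * Complex.I)) atTop (nhds 0) := by
  have key : Tendsto (fun R => ∫ u : ℝ in 0..c, airyKernel t y (a R + u * Complex.I)) atTop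
      (nhds (∫ _ : ℝ in 0..c, (0 : ℂ))) := by
    refine intervalIntegral.tendsto_integral_filter_of_dominated_convergence
      (fun u => Real.exp (t * u ^ 3 / 3 - u * y)) ?_ ?_ ?_ ?_
    · exact Eventually.of_forall fun R =>
        ((differentiable_airyKernel t y).continuous.comp (by fun_prop)).aestronglyMeasurable
    · refine Eventually.of_forall fun R => ae_of_all _ fun u hu => ?_
      rw [Set.uIoc_of_le hc.le] at hu
      rw [norm_airyKernel]
      have : 0 ≤ t * u * a R ^ 2 := mul_nonneg (mul_pos ht hu.1).le (sq_nonneg _)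
      exact Real.exp_le_exp.mpr (by linarith)
    · exact Continuous.intervalIntegrable (by fun_prop) _ _
    · refine ae_of_all _ fun u hu => ?_
      rw [Set.uIoc_of_le hc.le] at hu
      rw [tendsto_zero_iff_norm_tendsto_zero]
      simp only [norm_airyKernel]
      exact Real.tendsto_exp_atBot.comp (tendsto_atBot_add_const_right _ _
        (tendsto_neg_atTop_atBot.comp (ha.const_mul_atTop (mul_pos ht hu.1))))
  simpa using key

/-- Shifting the contour of the improper Airy integral into the upper half plane. -/
lemma tendsto_integral_airyKernel {t c : ℝ} (ht : 0 < t) (hc : 0 < c) (y : ℝ) :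
    Tendsto (fun R : ℝ => ∫ l : ℝ in (-R)..R, airyKernel t y l) atTop
      (nhds (∫ l : ℝ, airyKernel t y (l + c * Complex.I))) := by
  have hhor := intervalIntegral_tendsto_integral (integrable_airyKernel_horizontal ht hc y)
    tendsto_neg_atTop_atBot tendsto_id
  have hright := tendsto_integral_airyKernel_vertical ht hc y (a := fun R => R)
    (tendsto_pow_atTop two_ne_zero)
  have hleft := tendsto_integral_airyKernel_vertical ht hc y (a := fun R => -R)
    (by simp)
  have h := (hhor.sub (hright.const_mul Complex.I)).add (hleft.const_mul Complex.I)
  simp only [mul_zero, sub_zero, add_zero] at h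
  refine h.congr fun R => ?_
  have hrect := Complex.integral_boundary_rect_eq_zero_of_differentiableOn (airyKernel t y)
    (-R : ℝ) (R + c * Complex.I) (differentiable_airyKernel t y).differentiableOn
  simp only [Complex.ofReal_re, Complex.ofReal_im, Complex.add_re, Complex.add_im,
    Complex.re_ofReal_mul, Complex.im_ofReal_mul, Complex.I_re, Complex.I_im, mul_zero, mul_one,
    add_zero, zero_add, Complex.ofReal_zero, zero_mul, smul_eq_mul] at hrect
  simp only [id]
  linear_combination -hrect

/-- Rescaling the integration variable by the real cube root `r` of `t⁻¹`. -/
lemma integral_airyKernel_eq_scaled {t r : ℝ} (hr : r ≠ 0) (h : t * r ^ 3 = 1) (y R : ℝ) :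
    ∫ l : ℝ in (-R)..R, airyKernel t y l
      = r * ∫ l : ℝ in (-(R / r))..(R / r), airyKernel 1 (r * y) l := by
  have hsub := intervalIntegral.smul_integral_comp_mul_left (a := -(R / r)) (b := R / r)
    (fun l : ℝ => airyKernel t y l) r
  rw [mul_neg, mul_div_cancel₀ R hr] at hsub
  rw [← hsub, Complex.real_smul]
  congr 2
  funext l
  have h' : (t : ℂ) * (r : ℂ) ^ 3 = 1 := by exact_mod_cast h
  unfold airyKernel
  congr 1
  push_cast
  linear_combination Complex.I * (l : ℂ) ^ 3 / 3 * h'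

/-- For `t > 0`, `s > 0` and `x ∈ ℝ`,
`(1/(2π)) ∫ exp((iλ³/3 − sλ²/2)t + iλx) dλ
  = exp(s³t/12 + sx/2) · t^{−1/3} · Ai(t^{−1/3}(x + s²t/4))`,
where `Ai` is the Airy function defined by the improper oscillatory integral. -/
theorem stmt_10
    (Ai : ℝ → ℝ)
    (hAi : ∀ x : ℝ, Tendsto
      (fun R : ℝ => (1 / (2 * (Real.pi : ℂ))) *
        ∫ l : ℝ in (-R)..R, Complex.exp (Complex.I * ((l : ℂ) ^ 3 / 3 + (l : ℂ) * (x : ℂ))))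
      atTop (nhds ((Ai x : ℝ) : ℂ)))
    (t s : ℝ) (ht : 0 < t) (hs : 0 < s) (x : ℝ) :
    (1 / (2 * (Real.pi : ℂ))) *
      ∫ l : ℝ, Complex.exp ((Complex.I * (l : ℂ) ^ 3 / 3
        - (1 / 2) * (s : ℂ) * (l : ℂ) ^ 2) * (t : ℂ) + Complex.I * (l : ℂ) * (x : ℂ))
    = ((Real.exp (s ^ 3 * t / 12 + s * x / 2) * t ^ (-(1 : ℝ)/3)
        * Ai (t ^ (-(1 : ℝ)/3) * (x + s ^ 2 * t / 4)) : ℝ) : ℂ) := by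
  set r : ℝ := t ^ (-(1 : ℝ) / 3) with hr_def
  set y : ℝ := x + s ^ 2 * t / 4 with hy_def
  have hr : 0 < r := Real.rpow_pos_of_pos ht _
  have hr3 : t * r ^ 3 = 1 := by
    rw [hr_def, ← Real.rpow_natCast, ← Real.rpow_mul ht.le]
    norm_num [Real.rpow_neg_one, ht.ne']
  have hshift : ∀ l : ℝ, Complex.exp ((Complex.I * (l : ℂ) ^ 3 / 3
      - (1 / 2) * (s : ℂ) * (l : ℂ) ^ 2) * (t : ℂ) + Complex.I * (l : ℂ) * (x : ℂ))
      = (Real.exp (s ^ 3 * t / 12 + s * x / 2) : ℂ)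
        * airyKernel t y (l + (s / 2 : ℝ) * Complex.I) := by
    intro l
    rw [Complex.ofReal_exp, airyKernel, ← Complex.exp_add, hy_def]
    congr 1
    push_cast
    linear_combination -(t * (l : ℂ) ^ 2 * (s / 2) + t * l * (s / 2) ^ 2 * Complex.I
      + t * (s / 2) ^ 3 / 3 * (Complex.I ^ 2 - 1) + s / 2 * (x + s ^ 2 * t / 4)) * Complex.I_sq
  have hcontour := (tendsto_integral_airyKernel ht (half_pos hs) y).const_mul
    (1 / (2 * (Real.pi : ℂ)))
  have hairy := ((hAi (r * y)).comp (tendsto_id.atTop_div_const hr)).const_mul (r : ℂ)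
  have heq := tendsto_nhds_unique hcontour (hairy.congr fun R => by
    rw [integral_airyKernel_eq_scaled hr.ne' hr3]
    simp only [Function.comp, id, airyKernel, Complex.ofReal_one, one_mul]
    ring)
  simp only [hshift]
  rw [integral_const_mul]
  push_cast at heq ⊢
  linear_combination Complex.exp (s ^ 3 * t / 12 + s * x / 2) * heq
end

section
/- Let n ∈ ℕ with n ≥ 1, a ∈ ℂ with Re(a·(iλ)ⁿ) ≤ 0 for all λ ∈ ℝ, and let t > 0, s > 0. Then the function x ↦ (1/(2π)) ∫_ℝ exp{a·(iλ)ⁿ − (1/2)·s·λ² + iλx} dλ, regarded as a function v(s,x) of the two variables (s,x) ∈ (0,∞) × ℝ, satisfies the heat equation ∂v/∂s (s,x) = (1/2) ∂²v/∂x² (s,x) for all s > 0 and x ∈ ℝ. -/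
open MeasureTheory

/-- The Fourier-side heat kernel `exp(p(l) − s l² / 2 + i l x)` with symbol `p`. -/
noncomputable def heatMode (p : ℝ → ℂ) (s x l : ℝ) : ℂ :=
  Complex.exp (p l - (1 / 2) * (s : ℂ) * (l : ℂ) ^ 2 + Complex.I * (l : ℂ) * (x : ℂ))

theorem continuous_heatMode {p : ℝ → ℂ} (hp : Continuous p) (s x : ℝ) :
    Continuous (heatMode p s x) := by
  unfold heatMode
  fun_prop

theorem norm_heatMode_le {p : ℝ → ℂ} (hre : ∀ l, (p l).re ≤ 0) (s x l : ℝ) :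
    ‖heatMode p s x l‖ ≤ Real.exp (-(s / 2) * l ^ 2) := by
  have hquad : ((1 / 2 : ℂ) * (s : ℂ) * (l : ℂ) ^ 2) = ((s / 2 * l ^ 2 : ℝ) : ℂ) := by
    push_cast
    ring
  rw [heatMode, Complex.norm_exp, hquad, Real.exp_le_exp, Complex.add_re, Complex.sub_re,
    Complex.ofReal_re]
  have him : (Complex.I * (l : ℂ) * (x : ℂ)).re = 0 := by simp
  linarith [hre l]

theorem integrable_abs_pow_mul_exp_neg_mul_sq {b : ℝ} (hb : 0 < b) (k : ℕ) :
    Integrable fun l : ℝ => |l| ^ k * Real.exp (-b * l ^ 2) := by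
  have hk : (-1 : ℝ) < (k : ℝ) := by linarith [k.cast_nonneg (α := ℝ)]
  simpa [Real.rpow_natCast, abs_mul, abs_pow] using (integrable_rpow_mul_exp_neg_mul_sq hb hk).norm

theorem norm_pow_mul_heatMode_le {p : ℝ → ℂ} (hre : ∀ l, (p l).re ≤ 0) (s x l : ℝ) (k : ℕ) :
    ‖(Complex.I * (l : ℂ)) ^ k * heatMode p s x l‖ ≤ |l| ^ k * Real.exp (-(s / 2) * l ^ 2) := by
  rw [norm_mul, norm_pow, norm_mul, Complex.norm_I, one_mul, Complex.norm_real, Real.norm_eq_abs]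
  gcongr
  exact norm_heatMode_le hre s x l

theorem integrable_pow_mul_heatMode {p : ℝ → ℂ} (hp : Continuous p) (hre : ∀ l, (p l).re ≤ 0)
    {s : ℝ} (hs : 0 < s) (x : ℝ) (k : ℕ) :
    Integrable fun l : ℝ => (Complex.I * (l : ℂ)) ^ k * heatMode p s x l := by
  have hcont := continuous_heatMode hp s x
  exact (integrable_abs_pow_mul_exp_neg_mul_sq (half_pos hs) k).mono'
    (by fun_prop : Continuous _).aestronglyMeasurable
    (.of_forall fun l => norm_pow_mul_heatMode_le hre s x l k)

theorem hasDerivAt_heatMode_space (p : ℝ → ℂ) (s x l : ℝ) :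
    HasDerivAt (fun y => heatMode p s y l) (Complex.I * (l : ℂ) * heatMode p s x l) x := by
  have h := (((Complex.ofRealCLM.hasDerivAt (x := x)).const_mul (Complex.I * (l : ℂ))).const_add
    (p l - (1 / 2) * (s : ℂ) * (l : ℂ) ^ 2)).cexp
  simpa [heatMode, mul_comm] using h

theorem hasDerivAt_heatMode_time (p : ℝ → ℂ) (s x l : ℝ) :
    HasDerivAt (fun r => heatMode p r x l)
      ((1 / 2) * ((Complex.I * (l : ℂ)) ^ 2 * heatMode p s x l)) s := by
  have h := (((((Complex.ofRealCLM.hasDerivAt (x := s)).const_mul (1 / 2 : ℂ)).mul_const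
    ((l : ℂ) ^ 2)).const_sub (p l)).add_const (Complex.I * (l : ℂ) * (x : ℂ))).cexp
  refine h.congr_deriv ?_
  simp only [heatMode, mul_pow, Complex.I_sq, Complex.ofRealCLM_apply, Complex.ofReal_one]
  ring

theorem hasDerivAt_integral_pow_mul_heatMode {p : ℝ → ℂ} (hp : Continuous p)
    (hre : ∀ l, (p l).re ≤ 0) {s : ℝ} (hs : 0 < s) (x : ℝ) (k : ℕ) :
    HasDerivAt (fun y => ∫ l : ℝ, (Complex.I * (l : ℂ)) ^ k * heatMode p s y l)
      (∫ l : ℝ, (Complex.I * (l : ℂ)) ^ (k + 1) * heatMode p s x l) x := by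
  refine (hasDerivAt_integral_of_dominated_loc_of_deriv_le
    (F' := fun y l => (Complex.I * (l : ℂ)) ^ (k + 1) * heatMode p s y l) Filter.univ_mem
    (.of_forall fun y => (integrable_pow_mul_heatMode hp hre hs y k).aestronglyMeasurable)
    (integrable_pow_mul_heatMode hp hre hs x k)
    (integrable_pow_mul_heatMode hp hre hs x (k + 1)).aestronglyMeasurable
    (.of_forall fun l y _ => norm_pow_mul_heatMode_le hre s y l (k + 1))
    (integrable_abs_pow_mul_exp_neg_mul_sq (half_pos hs) (k + 1))
    (.of_forall fun l y _ => ?_)).2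
  simpa only [pow_succ, mul_assoc] using
    (hasDerivAt_heatMode_space p s y l).const_mul ((Complex.I * (l : ℂ)) ^ k)

theorem hasDerivAt_integral_heatMode_time {p : ℝ → ℂ} (hp : Continuous p)
    (hre : ∀ l, (p l).re ≤ 0) {s : ℝ} (hs : 0 < s) (x : ℝ) :
    HasDerivAt (fun r => ∫ l : ℝ, heatMode p r x l)
      ((1 / 2) * ∫ l : ℝ, (Complex.I * (l : ℂ)) ^ 2 * heatMode p s x l) s := by
  rw [← integral_const_mul]
  refine (hasDerivAt_integral_of_dominated_loc_of_deriv_le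
    (F' := fun r l => (1 / 2) * ((Complex.I * (l : ℂ)) ^ 2 * heatMode p r x l))
    (bound := fun l => |l| ^ 2 * Real.exp (-(s / 2 / 2) * l ^ 2))
    (Ioi_mem_nhds (half_lt_self hs))
    (.of_forall fun r => (continuous_heatMode hp r x).aestronglyMeasurable)
    (by simpa using integrable_pow_mul_heatMode hp hre hs x 0)
    ((integrable_pow_mul_heatMode hp hre hs x 2).const_mul _).aestronglyMeasurable
    (.of_forall fun l r hr => ?_)
    (integrable_abs_pow_mul_exp_neg_mul_sq (half_pos (half_pos hs)) 2)
    (.of_forall fun l r _ => hasDerivAt_heatMode_time p r x l)).2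
  have hr' : s / 2 ≤ r := le_of_lt hr
  calc ‖(1 / 2 : ℂ) * ((Complex.I * (l : ℂ)) ^ 2 * heatMode p r x l)‖
      ≤ ‖(Complex.I * (l : ℂ)) ^ 2 * heatMode p r x l‖ := by
        rw [norm_mul]
        exact mul_le_of_le_one_left (norm_nonneg _) (by norm_num)
    _ ≤ |l| ^ 2 * Real.exp (-(r / 2) * l ^ 2) := norm_pow_mul_heatMode_le hre r x l 2
    _ ≤ |l| ^ 2 * Real.exp (-(s / 2 / 2) * l ^ 2) := by gcongr

/-- For `n ≥ 1` and `a ∈ ℂ` with `Re(a(iλ)ⁿ) ≤ 0` for all real `λ`, the function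
`v(s,x) = (1/(2π)) ∫ exp(a(iλ)ⁿ − sλ²/2 + iλx) dλ` satisfies the heat equation
`∂v/∂s = (1/2) ∂²v/∂x²` for all `s > 0`, `x ∈ ℝ`. -/
theorem stmt_19 (n : ℕ) (hn : 1 ≤ n) (a : ℂ)
    (ha : ∀ l : ℝ, (a * (Complex.I * (l : ℂ)) ^ n).re ≤ 0)
    (v : ℝ → ℝ → ℂ)
    (hv : ∀ s x : ℝ, v s x = (1 / (2 * (Real.pi : ℂ))) *
      ∫ l : ℝ, Complex.exp (a * (Complex.I * (l : ℂ)) ^ n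
        - (1 / 2) * (s : ℂ) * (l : ℂ) ^ 2 + Complex.I * (l : ℂ) * (x : ℂ))) :
    ∀ s : ℝ, 0 < s → ∀ x : ℝ,
      deriv (fun s' : ℝ => v s' x) s
        = (1 / 2) * iteratedDeriv 2 (fun x' : ℝ => v s x') x := by
  intro s hs x
  let p : ℝ → ℂ := fun l => a * (Complex.I * (l : ℂ)) ^ n
  have hp : Continuous p := by fun_prop
  have hv' : ∀ s x, v s x = (1 / (2 * (Real.pi : ℂ))) * ∫ l : ℝ, heatMode p s x l := hv
  have htime := (hasDerivAt_integral_heatMode_time hp ha hs x).const_mul (1 / (2 * (Real.pi : ℂ)))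
  have hspace (k : ℕ) (y : ℝ) := (hasDerivAt_integral_pow_mul_heatMode hp ha hs y k).const_mul
    (1 / (2 * (Real.pi : ℂ)))
  have hfirst : deriv (fun y => v s y) = fun y => (1 / (2 * (Real.pi : ℂ))) *
      ∫ l : ℝ, (Complex.I * (l : ℂ)) ^ 1 * heatMode p s y l := by
    funext y
    simp only [hv']
    simpa only [pow_zero, one_mul] using (hspace 0 y).deriv
  rw [iteratedDeriv_succ, iteratedDeriv_one, hfirst, (hspace 1 x).deriv]
  simp only [hv']
  rw [htime.deriv]
  ring
end
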